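/- Let R ∈ ℝ^{n×n} be symmetric positive semidefinite, let P satisfy the four Penrose conditions with respect to R, and let S ∈ ℝ^{m×n} satisfy S P R = S. Let M₀ be a matrix of rank at most k minimizing ‖S − M‖_F over all matrices M ∈ ℝ^{m×n} of rank at most k. Then F₀ := M₀ P has rank at most k, ‖S − F₀ R‖_F = ‖S − M₀‖_F, and for every F ∈ ℝ^{m×n} of rank at most k, ‖S − F₀ R‖_F ≤ ‖S − F R‖_F. -/

import Mathlib

open Matrix

/-- The Frobenius norm of a real matrix. -/
noncomputable def frob {m n : Type*} [Fintype m] [Fintype n] (A : Matrix m n ℝ) : ℝ :=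
  Real.sqrt (∑ i, ∑ j, (A i j) ^ 2)

/-- `P` satisfies the four Penrose conditions with respect to `A`
(i.e. `P` is the Moore–Penrose pseudoinverse of `A`). -/
def IsPenrose {m n : Type*} [Fintype m] [Fintype n]
    (A : Matrix m n ℝ) (P : Matrix n m ℝ) : Prop :=
  A * P * A = A ∧ P * A * P = P ∧ (A * P)ᵀ = A * P ∧ (P * A)ᵀ = P * A

theorem frob_eq_sqrt_trace {m n : Type*} [Fintype m] [Fintype n] (A : Matrix m n ℝ) :
    frob A = Real.sqrt (A * Aᵀ).trace := by
  simp [frob, Matrix.trace, Matrix.mul_apply, sq]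

theorem trace_mul_transpose_self_nonneg {m n : Type*} [Fintype m] [Fintype n]
    (A : Matrix m n ℝ) : 0 ≤ (A * Aᵀ).trace := by
  simp only [Matrix.trace, Matrix.diag_apply, Matrix.mul_apply, Matrix.transpose_apply]
  exact Finset.sum_nonneg fun _ _ => Finset.sum_nonneg fun _ _ => mul_self_nonneg _

/-- Right multiplication by an orthogonal projection does not increase the Frobenius norm. -/
theorem frob_mul_le_of_isProj {m n : Type*} [Fintype m] [Fintype n]
    (A : Matrix m n ℝ) {Q : Matrix n n ℝ} (hsymm : Qᵀ = Q) (hidem : Q * Q = Q) :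
    frob (A * Q) ≤ frob A := by
  rw [frob_eq_sqrt_trace, frob_eq_sqrt_trace]
  apply Real.sqrt_le_sqrt
  have hproj : A * Q * (A * Q)ᵀ = A * Q * Aᵀ := by
    rw [Matrix.transpose_mul, hsymm, ← Matrix.mul_assoc, Matrix.mul_assoc A, hidem]
  have hcompl : (A - A * Q) * (A - A * Q)ᵀ = A * Aᵀ - A * Q * Aᵀ := by
    have hcross : A * (A * Q)ᵀ = A * Q * Aᵀ := by
      rw [Matrix.transpose_mul, hsymm, Matrix.mul_assoc]
    rw [Matrix.transpose_sub, Matrix.sub_mul, Matrix.mul_sub, Matrix.mul_sub, hproj, hcross]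
    abel
  have hnonneg := trace_mul_transpose_self_nonneg (A - A * Q)
  rw [hcompl, Matrix.trace_sub] at hnonneg
  rw [hproj]
  linarith

theorem stmt8 {m n k : ℕ}
    (R : Matrix (Fin n) (Fin n) ℝ) (hRsymm : Rᵀ = R) (hR : R.PosSemidef)
    (P : Matrix (Fin n) (Fin n) ℝ) (hP : IsPenrose R P)
    (S : Matrix (Fin m) (Fin n) ℝ) (hS : S * P * R = S)
    (M₀ : Matrix (Fin m) (Fin n) ℝ) (hM₀rank : M₀.rank ≤ k)
    (hM₀ : ∀ M : Matrix (Fin m) (Fin n) ℝ, M.rank ≤ k → frob (S - M₀) ≤ frob (S - M)) :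
    (M₀ * P).rank ≤ k ∧ frob (S - M₀ * P * R) = frob (S - M₀) ∧
    ∀ F : Matrix (Fin m) (Fin n) ℝ, F.rank ≤ k →
      frob (S - M₀ * P * R) ≤ frob (S - F * R) := by
  obtain ⟨-, hPRP, -, hsymm⟩ := hP
  have hrank : (M₀ * P).rank ≤ k := (Matrix.rank_mul_le_left M₀ P).trans hM₀rank
  have hidem : P * R * (P * R) = P * R := by rw [← Matrix.mul_assoc, hPRP]
  have hfactor : S - M₀ * P * R = (S - M₀) * (P * R) := by
    rw [Matrix.sub_mul, ← Matrix.mul_assoc, ← Matrix.mul_assoc, hS]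
  have hle : frob (S - M₀ * P * R) ≤ frob (S - M₀) := by
    rw [hfactor]
    exact frob_mul_le_of_isProj _ hsymm hidem
  exact ⟨hrank, hle.antisymm (hM₀ _ ((Matrix.rank_mul_le_left _ R).trans hrank)),
    fun F hF => hle.trans (hM₀ _ ((Matrix.rank_mul_le_left F R).trans hF))⟩
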